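/- Let L > 0, set λ = (2π/L)⁴, and let h₁, h₂ be smooth solutions of the Metropolis crystal-surface PDE on t ≥ 0 whose initial difference is mean-zero, ∫₀ᴸ (h₁(0,x) − h₂(0,x)) dx = 0. Then the flow is an exponential contraction: for all t ≥ 0, ∫₀ᴸ (h₁(t,x) − h₂(t,x))² dx ≤ e^{−2λ t} ∫₀ᴸ (h₁(0,x) − h₂(0,x))² dx. In particular, two smooth solutions with the same initial profile coincide for all t ≥ 0 (uniqueness). -/

import Mathlib

open MeasureTheory intervalIntegral Set Filter Topology
open scoped ContDiff

/-- Differentiation under the integral sign for a jointly `C¹` integrand. -/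
theorem hasDerivAt_intervalIntegral_of_contDiff {f : ℝ → ℝ → ℝ}
    (hf : ContDiff ℝ 1 (fun p : ℝ × ℝ => f p.1 p.2)) (a b t : ℝ) :
    HasDerivAt (fun s => ∫ x in a..b, f s x) (∫ x in a..b, deriv (fun s => f s x) t) t := by
  have hslice : ∀ s x, HasDerivAt (fun s => f s x)
      (fderiv ℝ (fun p : ℝ × ℝ => f p.1 p.2) (s, x) (1, 0)) s := fun s x =>
    HasFDerivAt.comp_hasDerivAt (f := fun s => (s, x)) s
      (hf.differentiable one_ne_zero (s, x)).hasFDerivAt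
      ((hasDerivAt_id s).prodMk (hasDerivAt_const s x))
  have hcont : Continuous fun p : ℝ × ℝ => deriv (fun s => f s p.2) p.1 := by
    simp only [fun s x => (hslice s x).deriv]
    exact (hf.continuous_fderiv one_ne_zero).clm_apply continuous_const
  obtain ⟨C, hC⟩ := ((isCompact_Icc (a := t - 1) (b := t + 1)).prod
    (isCompact_uIcc (a := a) (b := b))).exists_bound_of_continuousOn hcont.continuousOn
  refine (hasDerivAt_integral_of_dominated_loc_of_deriv_le
    (F' := fun s x => deriv (fun s => f s x) s) (bound := fun _ => C)
    (Icc_mem_nhds (sub_one_lt t) (lt_add_one t)) (Eventually.of_forall fun s => ?_) ?_ ?_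
    (ae_of_all _ fun x hx s hs => hC (s, x) ⟨hs, uIoc_subset_uIcc hx⟩) intervalIntegrable_const
    (ae_of_all _ fun x _ s _ => (hslice s x).differentiableAt.hasDerivAt)).2
  · exact (hf.continuous.comp (Continuous.prodMk_right s)).aestronglyMeasurable
  · exact (hf.continuous.comp (Continuous.prodMk_right t)).intervalIntegrable _ _
  · exact (hcont.comp (Continuous.prodMk_right t)).aestronglyMeasurable

theorem Function.Periodic.deriv_real {f : ℝ → ℝ} {c : ℝ} (hf : Function.Periodic f c) :
    Function.Periodic (deriv f) c := fun x => by
  rw [← deriv_comp_add_const, show (fun y => f (y + c)) = f from funext hf]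

theorem Function.Periodic.integral_deriv_eq_zero {f : ℝ → ℝ} {c : ℝ} (hf : Function.Periodic f c)
    (hsmooth : ContDiff ℝ 1 f) : ∫ x in (0 : ℝ)..c, deriv f x = 0 := by
  rw [integral_deriv_eq_sub (fun x _ => hsmooth.differentiable one_ne_zero x)
    ((hsmooth.continuous_deriv le_rfl).intervalIntegrable _ _), hf.eq, sub_self]

/-- Integrating by parts twice over a period moves a second derivative across a product. -/
theorem Function.Periodic.integral_mul_deriv_deriv {u v : ℝ → ℝ} {c : ℝ}
    (hu : Function.Periodic u c) (hv : Function.Periodic v c)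
    (husmooth : ContDiff ℝ ∞ u) (hvsmooth : ContDiff ℝ ∞ v) :
    ∫ x in (0 : ℝ)..c, u x * deriv (deriv v) x = ∫ x in (0 : ℝ)..c, deriv (deriv u) x * v x := by
  have hu' := (contDiff_infty_iff_deriv.1 husmooth).2
  have hv' := (contDiff_infty_iff_deriv.1 hvsmooth).2
  have hasDeriv : ∀ {g : ℝ → ℝ}, ContDiff ℝ ∞ g → ∀ x ∈ uIcc 0 c, HasDerivAt g (deriv g x) x :=
    fun hg x _ => (contDiff_infty_iff_deriv.1 hg).1.differentiableAt.hasDerivAt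
  have hint : ∀ {g : ℝ → ℝ}, ContDiff ℝ ∞ g → IntervalIntegrable (deriv g) volume 0 c :=
    fun hg => (contDiff_infty_iff_deriv.1 hg).2.continuous.intervalIntegrable _ _
  rw [integral_mul_deriv_eq_deriv_mul (hasDeriv husmooth) (hasDeriv hv')
      (hint husmooth) (hint hv'),
    integral_mul_deriv_eq_deriv_mul (hasDeriv hu') (hasDeriv hvsmooth) (hint hu') (hint hvsmooth),
    hu.eq, hv.eq, hu.deriv_real.eq, hv.deriv_real.eq]
  ring

/-- **Wirtinger's inequality** for mean-zero periodic functions. -/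
theorem Function.Periodic.wirtinger {f : ℝ → ℝ} {L : ℝ} (hL : 0 < L)
    (hf : Function.Periodic f L) (hsmooth : ContDiff ℝ 1 f)
    (hmean : ∫ x in (0 : ℝ)..L, f x = 0) :
    (2 * Real.pi / L) ^ 2 * ∫ x in (0 : ℝ)..L, f x ^ 2 ≤ ∫ x in (0 : ℝ)..L, deriv f x ^ 2 := by
  have hparseval : ∀ {g : ℝ → ℝ}, Continuous g →
      HasSum (fun n => ‖fourierCoeffOn hL (fun x => (g x : ℂ)) n‖ ^ 2)
        (L⁻¹ * ∫ x in (0 : ℝ)..L, g x ^ 2) := by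
    intro g hg
    have hgc : Continuous fun x => (g x : ℂ) := Complex.continuous_ofReal.comp hg
    obtain ⟨C, hC⟩ := (isCompact_Icc (a := (0 : ℝ)) (b := L)).exists_bound_of_continuousOn
      hgc.continuousOn
    have hmem : MemLp (fun x => (g x : ℂ)) 2 (volume.restrict (Ioc 0 L)) :=
      MemLp.of_bound hgc.aestronglyMeasurable C
        ((ae_restrict_iff' measurableSet_Ioc).2
          (ae_of_all _ fun x hx => hC x (Ioc_subset_Icc_self hx)))
    simpa using hasSum_sq_fourierCoeffOn hL hmem
  have hderiv := hsmooth.continuous_deriv le_rfl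
  have hcoeff : ∀ n : ℤ, (2 * Real.pi / L) ^ 2 *
      ‖fourierCoeffOn hL (fun x => (f x : ℂ)) n‖ ^ 2 ≤
        ‖fourierCoeffOn hL (fun x => ((deriv f x : ℝ) : ℂ)) n‖ ^ 2 := by
    intro n
    rcases eq_or_ne n 0 with rfl | hn
    · have hzero : fourierCoeffOn hL (fun x => (f x : ℂ)) 0 = 0 := by
        simp [fourierCoeffOn_eq_integral, intervalIntegral.integral_ofReal, hmean]
      rw [hzero]
      simp
    · have hn1 : (1 : ℝ) ≤ |(n : ℝ)| := by exact_mod_cast Int.one_le_abs hn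
      have heq := fourierCoeffOn_of_hasDerivAt hL hn
        (fun x _ => (hsmooth.differentiable one_ne_zero x).hasDerivAt.ofReal_comp)
        ((Complex.continuous_ofReal.comp hderiv).intervalIntegrable 0 L)
      have hnorm : ‖fourierCoeffOn hL (fun x => (f x : ℂ)) n‖ =
          (2 * Real.pi * |(n : ℝ)|)⁻¹ *
            (L * ‖fourierCoeffOn hL (fun x => ((deriv f x : ℝ) : ℂ)) n‖) := by
        rw [heq, hf.eq]
        simp [abs_of_pos Real.pi_pos, abs_of_pos hL]
      rw [← mul_pow]
      refine pow_le_pow_left₀ (by positivity) ?_ 2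
      rw [hnorm]
      calc _ = |(n : ℝ)|⁻¹ * ‖fourierCoeffOn hL (fun x => ((deriv f x : ℝ) : ℂ)) n‖ := by
            field_simp
        _ ≤ _ := mul_le_of_le_one_left (norm_nonneg _) (inv_le_one_of_one_le₀ hn1)
  have hle := hasSum_le hcoeff ((hparseval hsmooth.continuous).mul_left _) (hparseval hderiv)
  rw [mul_left_comm] at hle
  exact le_of_mul_le_mul_left hle (inv_pos.2 hL)

/-- The second-order Wirtinger inequality for mean-zero periodic functions. -/
theorem Function.Periodic.wirtinger_deriv_deriv {f : ℝ → ℝ} {L : ℝ} (hL : 0 < L)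
    (hf : Function.Periodic f L) (hsmooth : ContDiff ℝ ∞ f)
    (hmean : ∫ x in (0 : ℝ)..L, f x = 0) :
    (2 * Real.pi / L) ^ 4 * ∫ x in (0 : ℝ)..L, f x ^ 2 ≤
      ∫ x in (0 : ℝ)..L, deriv (deriv f) x ^ 2 := by
  have hsmooth₁ : ContDiff ℝ 1 f := hsmooth.of_le (by norm_num)
  have h₁ := hf.wirtinger hL hsmooth₁ hmean
  have h₂ := hf.deriv_real.wirtinger hL
    ((contDiff_infty_iff_deriv.1 hsmooth).2.of_le (by norm_num))
    (hf.integral_deriv_eq_zero hsmooth₁)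
  calc _ = (2 * Real.pi / L) ^ 2 * ((2 * Real.pi / L) ^ 2 * ∫ x in (0 : ℝ)..L, f x ^ 2) := by ring
    _ ≤ _ := (mul_le_mul_of_nonneg_left h₁ (by positivity)).trans h₂

theorem Real.sq_sub_le_sub_mul_sinh_sub_sinh (a b : ℝ) :
    (a - b) ^ 2 ≤ (a - b) * (Real.sinh a - Real.sinh b) := by
  rcases le_total a b with h | h
  · nlinarith [Real.sinh_sub_id_strictMono.monotone h]
  · nlinarith [Real.sinh_sub_id_strictMono.monotone h]

/-- A differentiable function whose derivative is at most `-k` times itself on `[0, ∞)` decays at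
least like `exp (-k t)`. -/
theorem le_exp_mul_of_hasDerivAt_le {E E' : ℝ → ℝ} {k : ℝ} (hE : ∀ t, HasDerivAt E (E' t) t)
    (hle : ∀ t, 0 ≤ t → E' t ≤ -k * E t) {t : ℝ} (ht : 0 ≤ t) :
    E t ≤ Real.exp (-k * t) * E 0 := by
  have hderiv : ∀ s, HasDerivAt (fun s => Real.exp (k * s) * E s)
      (Real.exp (k * s) * (E' s + k * E s)) s := fun s => by
    exact ((hasDerivAt_const_mul k).exp.mul (hE s)).congr_deriv (by ring)
  have hanti : AntitoneOn (fun s => Real.exp (k * s) * E s) (Ici 0) := by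
    refine antitoneOn_of_deriv_nonpos (convex_Ici 0)
      (fun s _ => (hderiv s).continuousAt.continuousWithinAt)
      (fun s _ => (hderiv s).differentiableAt.differentiableWithinAt) fun s hs => ?_
    rw [interior_Ici] at hs
    rw [(hderiv s).deriv]
    exact mul_nonpos_of_nonneg_of_nonpos (Real.exp_pos _).le (by linarith [hle s (le_of_lt hs)])
  have h := hanti self_mem_Ici ht ht
  simp only [mul_zero, Real.exp_zero, one_mul] at h
  rw [neg_mul, Real.exp_neg, inv_mul_eq_div, le_div_iff₀ (Real.exp_pos _), mul_comm]
  exact h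

/-- exponential L² contraction between two smooth solutions of
the Metropolis crystal-surface PDE whose initial difference is mean-zero,
with rate 2λ, λ = (2π/L)⁴; in particular, uniqueness of smooth solutions. -/
theorem exponential_contraction_and_uniqueness
    (L : ℝ) (hL : 0 < L)
    (h₁ h₂ : ℝ → ℝ → ℝ)
    (h₁smooth : ContDiff ℝ (⊤ : ℕ∞) (fun p : ℝ × ℝ => h₁ p.1 p.2))
    (h₂smooth : ContDiff ℝ (⊤ : ℕ∞) (fun p : ℝ × ℝ => h₂ p.1 p.2))
    (h₁per : ∀ t x, h₁ t (x + L) = h₁ t x)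
    (h₂per : ∀ t x, h₂ t (x + L) = h₂ t x)
    (h₁pde : ∀ t x, 0 ≤ t →
      deriv (fun s => h₁ s x) t
        = - deriv (deriv (fun y => Real.sinh (deriv (deriv (h₁ t)) y))) x)
    (h₂pde : ∀ t x, 0 ≤ t →
      deriv (fun s => h₂ s x) t
        = - deriv (deriv (fun y => Real.sinh (deriv (deriv (h₂ t)) y))) x)
    (hmean0 : ∫ x in (0:ℝ)..L, (h₁ 0 x - h₂ 0 x) = 0) :
    (∀ t, 0 ≤ t →
      (∫ x in (0:ℝ)..L, (h₁ t x - h₂ t x) ^ 2)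
        ≤ Real.exp (-2 * (2 * Real.pi / L) ^ 4 * t)
            * ∫ x in (0:ℝ)..L, (h₁ 0 x - h₂ 0 x) ^ 2)
    ∧ ((∀ x, h₁ 0 x = h₂ 0 x) → ∀ t x, 0 ≤ t → h₁ t x = h₂ t x) := by
  have slice : ∀ {h : ℝ → ℝ → ℝ}, ContDiff ℝ ∞ (fun p : ℝ × ℝ => h p.1 p.2) →
      ∀ t, ContDiff ℝ ∞ (h t) := fun hh t => hh.comp (contDiff_prodMk_right t)
  have hderiv : ∀ {g : ℝ → ℝ}, ContDiff ℝ ∞ g → ContDiff ℝ ∞ (deriv g) :=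
    fun hg => (contDiff_infty_iff_deriv.1 hg).2
  have hdiff : ∀ {g : ℝ → ℝ}, ContDiff ℝ ∞ g → Differentiable ℝ g :=
    fun hg => (contDiff_infty_iff_deriv.1 hg).1
  set w : ℝ → ℝ → ℝ := fun t x => h₁ t x - h₂ t x with hw
  have hwsmooth : ContDiff ℝ ∞ (fun p : ℝ × ℝ => w p.1 p.2) := h₁smooth.sub h₂smooth
  have hwper : ∀ t, Function.Periodic (w t) L := fun t x => by
    simp only [hw, h₁per, h₂per]
  set S : ℝ → ℝ → ℝ := fun t x =>
    Real.sinh (deriv (deriv (h₁ t)) x) - Real.sinh (deriv (deriv (h₂ t)) x) with hS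
  have hsinh₁ : ∀ t, ContDiff ℝ ∞ (fun x => Real.sinh (deriv (deriv (h₁ t)) x)) :=
    fun t => (hderiv (hderiv (slice h₁smooth t))).sinh
  have hsinh₂ : ∀ t, ContDiff ℝ ∞ (fun x => Real.sinh (deriv (deriv (h₂ t)) x)) :=
    fun t => (hderiv (hderiv (slice h₂smooth t))).sinh
  have hSsmooth : ∀ t, ContDiff ℝ ∞ (S t) := fun t => (hsinh₁ t).sub (hsinh₂ t)
  have hSper : ∀ t, Function.Periodic (S t) L := fun t x => by
    have e₁ := Function.Periodic.deriv_real (Function.Periodic.deriv_real (h₁per t)) x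
    have e₂ := Function.Periodic.deriv_real (Function.Periodic.deriv_real (h₂per t)) x
    simp only [hS, e₁, e₂]
  have deriv_deriv_sub : ∀ {f g : ℝ → ℝ}, ContDiff ℝ ∞ f → ContDiff ℝ ∞ g → ∀ x,
      deriv (deriv fun y => f y - g y) x = deriv (deriv f) x - deriv (deriv g) x := by
    intro f g hf hg x
    rw [show deriv (fun y => f y - g y) = fun y => deriv f y - deriv g y from
      funext fun y => deriv_fun_sub (hdiff hf y) (hdiff hg y)]
    exact deriv_fun_sub (hdiff (hderiv hf) x) (hdiff (hderiv hg) x)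
  have htime : ∀ {h : ℝ → ℝ → ℝ}, ContDiff ℝ ∞ (fun p : ℝ × ℝ => h p.1 p.2) →
      ∀ t x, DifferentiableAt ℝ (fun s => h s x) t := fun hh t x =>
    hdiff (hh.comp (contDiff_prodMk_left x)) t
  have hwpde : ∀ t x, 0 ≤ t → deriv (fun s => w s x) t = -deriv (deriv (S t)) x := by
    intro t x ht
    rw [deriv_fun_sub (htime h₁smooth t x) (htime h₂smooth t x), h₁pde t x ht, h₂pde t x ht,
      deriv_deriv_sub (hsinh₁ t) (hsinh₂ t)]
    ring
  have hmean : ∀ t, 0 ≤ t → ∫ x in (0 : ℝ)..L, w t x = 0 := by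
    intro t ht
    have hM := hasDerivAt_intervalIntegral_of_contDiff (hwsmooth.of_le (by norm_num)) 0 L
    have hM' : ∀ s, 0 ≤ s → ∫ x in (0 : ℝ)..L, deriv (fun r => w r x) s = 0 := fun s hs => by
      simp only [fun x => hwpde s x hs, intervalIntegral.integral_neg, neg_eq_zero]
      exact (hSper s).deriv_real.integral_deriv_eq_zero
        ((hderiv (hSsmooth s)).of_le (by norm_num))
    have hconst := constant_of_has_deriv_right_zero (a := 0) (b := t)
      (fun s _ => (hM s).continuousAt.continuousWithinAt)
      (fun s hs => by simpa only [hM' s hs.1] using (hM s).hasDerivWithinAt) t ⟨ht, le_rfl⟩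
    exact hconst.trans hmean0
  have hE := hasDerivAt_intervalIntegral_of_contDiff (f := fun t x => w t x ^ 2)
    ((hwsmooth.pow 2).of_le (by norm_num)) 0 L
  have hdissip : ∀ t, 0 ≤ t → ∫ x in (0 : ℝ)..L, deriv (fun s => w s x ^ 2) t ≤
      -(2 * (2 * Real.pi / L) ^ 4) * ∫ x in (0 : ℝ)..L, w t x ^ 2 := by
    intro t ht
    have hpt : ∀ x, deriv (fun s => w s x ^ 2) t = -2 * (w t x * deriv (deriv (S t)) x) := by
      intro x
      rw [deriv_fun_pow (htime hwsmooth t x), hwpde t x ht]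
      ring
    have hws := slice hwsmooth t
    simp only [hpt, intervalIntegral.integral_const_mul]
    rw [(hwper t).integral_mul_deriv_deriv (hSper t) hws (hSsmooth t)]
    have hwirt := (hwper t).wirtinger_deriv_deriv hL hws (hmean t ht)
    have hmono : ∫ x in (0 : ℝ)..L, deriv (deriv (w t)) x ^ 2 ≤
        ∫ x in (0 : ℝ)..L, deriv (deriv (w t)) x * S t x := by
      refine intervalIntegral.integral_mono_on hL.le
        (((hderiv (hderiv hws)).continuous.pow 2).intervalIntegrable _ _)
        (((hderiv (hderiv hws)).continuous.mul (hSsmooth t).continuous).intervalIntegrable _ _)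
        fun x _ => ?_
      rw [deriv_deriv_sub (slice h₁smooth t) (slice h₂smooth t)]
      exact Real.sq_sub_le_sub_mul_sinh_sub_sinh _ _
    linarith
  have hcontract : ∀ t, 0 ≤ t → (∫ x in (0:ℝ)..L, w t x ^ 2) ≤
      Real.exp (-2 * (2 * Real.pi / L) ^ 4 * t) * ∫ x in (0:ℝ)..L, w 0 x ^ 2 := by
    intro t ht
    simpa only [neg_mul] using le_exp_mul_of_hasDerivAt_le hE hdissip ht
  refine ⟨hcontract, fun h0 t x ht => ?_⟩
  have hle := hcontract t ht
  simp only [show ∀ y, w 0 y = 0 from fun y => sub_eq_zero.2 (h0 y)] at hle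
  simp only [ne_eq, OfNat.ofNat_ne_zero, not_false_eq_true, zero_pow,
    intervalIntegral.integral_zero, mul_zero] at hle
  obtain ⟨y, hy, hxy⟩ := (hwper t).exists_mem_Ico₀ hL x
  rw [← sub_eq_zero]
  change w t x = 0
  rw [hxy]
  by_contra hne
  exact hle.not_gt (intervalIntegral.integral_pos hL
    ((slice hwsmooth t).continuous.pow 2).continuousOn (fun z _ => sq_nonneg _)
    ⟨y, Ico_subset_Icc_self hy, by positivity⟩)
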